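/- Let Φ be an integral domain and let L_3(Φ) = L_Φ⟨x_1,x_2,x_3⟩. The set B_0 = {τ = (x_1 + h(x_2,x_3), x_2, x_3) : h(x_2,x_3) ∈ [L_3(Φ), L_3(Φ)]} is a full system of representatives of the left cosets of the subgroup H(Φ) = GL_3(Φ) ∩ B_3(Φ) in the group B_3(Φ): every μ ∈ B_3(Φ) factors as μ = τ ∘ γ with τ ∈ B_0 and γ ∈ H(Φ), and distinct elements τ ≠ τ′ of B_0 lie in distinct left cosets (τ^{-1} ∘ τ′ ∉ H(Φ)). -/

import Mathlib

/-- The group structure (under composition) on the Lie algebra automorphisms. -/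
noncomputable instance lieAutGroup (Φ : Type*) [CommRing Φ] (L : Type*)
    [LieRing L] [LieAlgebra Φ L] : Group (L ≃ₗ⁅Φ⁆ L) where
  mul e f := f.trans e
  one := LieEquiv.refl
  inv := LieEquiv.symm
  mul_assoc e f g := rfl
  one_mul e := rfl
  mul_one e := rfl
  inv_mul_cancel e := LieEquiv.ext fun x => e.symm_apply_apply x

/-- The free generators `x_1, x_2, x_3` of `L_3(Φ) = L_Φ⟨x_1,x_2,x_3⟩`. -/
noncomputable def xg (Φ : Type*) [CommRing Φ] (i : Fin 3) :
    FreeLieAlgebra Φ (Fin 3) :=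
  FreeLieAlgebra.of Φ i

/-- A linear automorphism of `L_3(Φ)`: each generator is sent to a `Φ`-linear
combination of the generators (membership in `GL_3(Φ)`). -/
def IsLinearAut (Φ : Type*) [CommRing Φ]
    (φ : FreeLieAlgebra Φ (Fin 3) ≃ₗ⁅Φ⁆ FreeLieAlgebra Φ (Fin 3)) : Prop :=
  ∀ i : Fin 3, φ (xg Φ i) ∈ Submodule.span Φ (Set.range (xg Φ))

/-- A triangular automorphism of `L_3(Φ)` (membership in `B_3(Φ)`):
`μ = (α₁x₁ + h(x₂,x₃), β₂x₂ + β₃x₃, γ₂x₂ + γ₃x₃)` with `α₁` and `β₂γ₃ - β₃γ₂`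
units of `Φ` and `h` in the subalgebra generated by `x₂, x₃`. -/
def IsTriangularAut (Φ : Type*) [CommRing Φ]
    (φ : FreeLieAlgebra Φ (Fin 3) ≃ₗ⁅Φ⁆ FreeLieAlgebra Φ (Fin 3)) : Prop :=
  ∃ (α₁ β₂ β₃ γ₂ γ₃ : Φ) (h : FreeLieAlgebra Φ (Fin 3)),
    IsUnit α₁ ∧ IsUnit (β₂ * γ₃ - β₃ * γ₂) ∧
    h ∈ LieSubalgebra.lieSpan Φ (FreeLieAlgebra Φ (Fin 3)) {xg Φ 1, xg Φ 2} ∧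
    φ (xg Φ 0) = α₁ • xg Φ 0 + h ∧
    φ (xg Φ 1) = β₂ • xg Φ 1 + β₃ • xg Φ 2 ∧
    φ (xg Φ 2) = γ₂ • xg Φ 1 + γ₃ • xg Φ 2

/-- Membership in the set `B₀ = {τ = (x₁ + h(x₂,x₃), x₂, x₃) : h ∈ [L₃(Φ),L₃(Φ)]}`. -/
def IsB0Aut (Φ : Type*) [CommRing Φ]
    (τ : FreeLieAlgebra Φ (Fin 3) ≃ₗ⁅Φ⁆ FreeLieAlgebra Φ (Fin 3)) : Prop :=
  ∃ h : FreeLieAlgebra Φ (Fin 3),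
    h ∈ LieSubalgebra.lieSpan Φ (FreeLieAlgebra Φ (Fin 3)) {xg Φ 1, xg Φ 2} ∧
    h ∈ LieAlgebra.derivedSeries Φ (FreeLieAlgebra Φ (Fin 3)) 1 ∧
    τ (xg Φ 0) = xg Φ 0 + h ∧ τ (xg Φ 1) = xg Φ 1 ∧ τ (xg Φ 2) = xg Φ 2

/-- The bracket of two elements lies in the derived subalgebra. -/
theorem lie_mem_derivedSeries_one {R L : Type*} [CommRing R] [LieRing L] [LieAlgebra R L]
    (x y : L) : ⁅x, y⁆ ∈ LieAlgebra.derivedSeries R L 1 := by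
  rw [LieAlgebra.derivedSeries_def, LieAlgebra.derivedSeriesOfIdeal_succ,
    LieAlgebra.derivedSeriesOfIdeal_zero]
  exact LieSubmodule.lie_mem_lie (LieSubmodule.mem_top x) (LieSubmodule.mem_top y)

/-- A Lie homomorphism into an abelian Lie algebra vanishes on the derived subalgebra. -/
theorem LieHom.eq_zero_of_mem_derivedSeries_one {R L M : Type*} [CommRing R] [LieRing L]
    [LieAlgebra R L] [LieRing M] [LieAlgebra R M] [IsLieAbelian M] (f : L →ₗ⁅R⁆ M) {x : L}
    (hx : x ∈ LieAlgebra.derivedSeries R L 1) : f x = 0 := by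
  have hle : LieAlgebra.derivedSeries R L 1 ≤ f.ker := by
    rw [LieAlgebra.derivedSeries_def, LieAlgebra.derivedSeriesOfIdeal_succ,
      LieAlgebra.derivedSeriesOfIdeal_zero, LieSubmodule.lie_le_iff]
    intro a _ b _
    rw [LieHom.mem_ker, LieHom.map_lie, trivial_lie_zero]
  exact f.mem_ker.1 (hle hx)

/-- An element of a free Lie algebra that is both linear in the generators and in the derived
subalgebra is zero. -/
theorem FreeLieAlgebra.eq_zero_of_mem_span_of_mem_derivedSeries_one {R X : Type*} [CommRing R]
    {x : FreeLieAlgebra R X} (hs : x ∈ Submodule.span R (Set.range (FreeLieAlgebra.of R)))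
    (hd : x ∈ LieAlgebra.derivedSeries R (FreeLieAlgebra R X) 1) : x = 0 := by
  let _ : LieRing (X → R) := LieRing.ofAssociativeRing
  let _ : LieAlgebra R (X → R) := LieAlgebra.ofAssociativeAlgebra
  have : IsLieAbelian (X → R) := ⟨fun a b => by
    rw [LieRing.of_associative_ring_bracket, mul_comm, sub_self]⟩
  classical
  obtain ⟨c, rfl⟩ := (Finsupp.mem_span_range_iff_exists_finsupp).1 hs
  have h0 := (FreeLieAlgebra.lift R
    (fun i : X => (Pi.single i 1 : X → R))).eq_zero_of_mem_derivedSeries_one hd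
  have hc : c = 0 := by
    ext j
    have hj := congrFun h0 j
    simpa [Finsupp.sum, Pi.single_apply] using hj
  simp [hc]

/-- Elements of the subalgebra generated by two elements `a, b` are linear combinations of `a, b`
modulo the derived subalgebra. -/
theorem exists_sub_mem_derivedSeries_one {R L : Type*} [CommRing R] [LieRing L] [LieAlgebra R L]
    {a b x : L} (hx : x ∈ LieSubalgebra.lieSpan R L {a, b}) :
    ∃ s t : R, x - (s • a + t • b) ∈ LieAlgebra.derivedSeries R L 1 := by
  induction hx using LieSubalgebra.lieSpan_induction with
  | mem y hy =>
    rcases hy with rfl | rfl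
    · exact ⟨1, 0, by simp⟩
    · exact ⟨0, 1, by simp⟩
  | zero => exact ⟨0, 0, by simp⟩
  | add y z _ _ hy hz =>
    obtain ⟨s, t, h⟩ := hy
    obtain ⟨s', t', h'⟩ := hz
    refine ⟨s + s', t + t', ?_⟩
    convert add_mem h h' using 1
    module
  | smul r y _ hy =>
    obtain ⟨s, t, h⟩ := hy
    refine ⟨r * s, r * t, ?_⟩
    have h' := (LieAlgebra.derivedSeries R L 1).smul_mem r h
    rwa [smul_sub, smul_add, smul_smul, smul_smul] at h'
  | lie y z _ _ _ _ => exact ⟨0, 0, by simpa using lie_mem_derivedSeries_one y z⟩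

/-- A Lie homomorphism fixing two elements fixes the subalgebra they generate. -/
theorem LieHom.apply_eq_self_of_mem_lieSpan_pair {R L : Type*} [CommRing R] [LieRing L]
    [LieAlgebra R L] (f : L →ₗ⁅R⁆ L) {a b x : L} (ha : f a = a) (hb : f b = b)
    (hx : x ∈ LieSubalgebra.lieSpan R L {a, b}) : f x = x := by
  induction hx using LieSubalgebra.lieSpan_induction with
  | mem y hy => rcases hy with rfl | rfl <;> assumption
  | zero => exact map_zero f
  | add y z _ _ hy hz => rw [map_add, hy, hz]
  | smul r y _ hy => rw [map_smul, hy]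
  | lie y z _ _ hy hz => rw [LieHom.map_lie, hy, hz]

/-- The endomorphism `(x₁ + h, x₂, x₃)` of `L₃(Φ)`. -/
noncomputable def elementaryHom (Φ : Type*) [CommRing Φ] (h : FreeLieAlgebra Φ (Fin 3)) :
    FreeLieAlgebra Φ (Fin 3) →ₗ⁅Φ⁆ FreeLieAlgebra Φ (Fin 3) :=
  FreeLieAlgebra.lift Φ ![xg Φ 0 + h, xg Φ 1, xg Φ 2]

section elementary

variable {Φ : Type*} [CommRing Φ]

theorem elementaryHom_zero (h : FreeLieAlgebra Φ (Fin 3)) :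
    elementaryHom Φ h (xg Φ 0) = xg Φ 0 + h := by
  simp [elementaryHom, xg]

theorem elementaryHom_one (h : FreeLieAlgebra Φ (Fin 3)) :
    elementaryHom Φ h (xg Φ 1) = xg Φ 1 := by
  simp [elementaryHom, xg]

theorem elementaryHom_two (h : FreeLieAlgebra Φ (Fin 3)) :
    elementaryHom Φ h (xg Φ 2) = xg Φ 2 := by
  simp [elementaryHom, xg]

theorem elementaryHom_comp {h k : FreeLieAlgebra Φ (Fin 3)} (hk : h + k = 0)
    (hh : k ∈ LieSubalgebra.lieSpan Φ (FreeLieAlgebra Φ (Fin 3)) {xg Φ 1, xg Φ 2}) :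
    (elementaryHom Φ h).comp (elementaryHom Φ k) = LieHom.id := by
  ext i
  rw [LieHom.comp_apply, LieHom.id_apply]
  change elementaryHom Φ h (elementaryHom Φ k (xg Φ i)) = xg Φ i
  fin_cases i
  · change elementaryHom Φ h (elementaryHom Φ k (xg Φ 0)) = xg Φ 0
    rw [elementaryHom_zero, map_add, elementaryHom_zero,
      (elementaryHom Φ h).apply_eq_self_of_mem_lieSpan_pair (elementaryHom_one h)
        (elementaryHom_two h) hh, add_assoc, hk, add_zero]
  · change elementaryHom Φ h (elementaryHom Φ k (xg Φ 1)) = xg Φ 1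
    rw [elementaryHom_one, elementaryHom_one]
  · change elementaryHom Φ h (elementaryHom Φ k (xg Φ 2)) = xg Φ 2
    rw [elementaryHom_two, elementaryHom_two]

/-- The automorphism `(x₁ + h(x₂, x₃), x₂, x₃)` of `L₃(Φ)`. -/
noncomputable def elementaryAut (h : FreeLieAlgebra Φ (Fin 3))
    (hh : h ∈ LieSubalgebra.lieSpan Φ (FreeLieAlgebra Φ (Fin 3)) {xg Φ 1, xg Φ 2}) :
    FreeLieAlgebra Φ (Fin 3) ≃ₗ⁅Φ⁆ FreeLieAlgebra Φ (Fin 3) :=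
  { elementaryHom Φ h with
    invFun := elementaryHom Φ (-h)
    left_inv := fun x => LieHom.congr_fun (elementaryHom_comp (neg_add_cancel h) hh) x
    right_inv := fun x =>
      LieHom.congr_fun (elementaryHom_comp (add_neg_cancel h) (neg_mem hh)) x }

theorem elementaryAut_inv_apply {h : FreeLieAlgebra Φ (Fin 3)}
    (hh : h ∈ LieSubalgebra.lieSpan Φ (FreeLieAlgebra Φ (Fin 3)) {xg Φ 1, xg Φ 2})
    (x : FreeLieAlgebra Φ (Fin 3)) : (elementaryAut h hh)⁻¹ x = elementaryHom Φ (-h) x := rfl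

theorem lieAut_mul_apply {L : Type*} [LieRing L] [LieAlgebra Φ L] (e f : L ≃ₗ⁅Φ⁆ L) (x : L) :
    (e * f) x = e (f x) := rfl

/-- Two Lie automorphisms of `L₃(Φ)` agreeing on the generators are equal. -/
theorem lieAut_ext {e f : FreeLieAlgebra Φ (Fin 3) ≃ₗ⁅Φ⁆ FreeLieAlgebra Φ (Fin 3)}
    (h : ∀ i, e (xg Φ i) = f (xg Φ i)) : e = f := by
  have : e.toLieHom = f.toLieHom := FreeLieAlgebra.hom_ext h
  exact LieEquiv.ext fun x => LieHom.congr_fun this x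

theorem xg_mem_span (i : Fin 3) : xg Φ i ∈ Submodule.span Φ (Set.range (xg Φ)) :=
  Submodule.subset_span ⟨i, rfl⟩

end elementary

/-- `B₀` is a full system of representatives of the left cosets of
`H(Φ) = GL₃(Φ) ∩ B₃(Φ)` in `B₃(Φ)`: every triangular automorphism `μ` factors as
`μ = τ ∘ γ` with `τ ∈ B₀` and `γ ∈ H(Φ)`, and distinct elements of `B₀` lie in
distinct left cosets. -/
theorem B0_left_coset_representatives
    (Φ : Type*) [CommRing Φ] [IsDomain Φ] :
    (∀ μ : FreeLieAlgebra Φ (Fin 3) ≃ₗ⁅Φ⁆ FreeLieAlgebra Φ (Fin 3),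
      IsTriangularAut Φ μ →
        ∃ τ γ, IsB0Aut Φ τ ∧ (IsLinearAut Φ γ ∧ IsTriangularAut Φ γ) ∧ μ = τ * γ) ∧
    (∀ τ τ' : FreeLieAlgebra Φ (Fin 3) ≃ₗ⁅Φ⁆ FreeLieAlgebra Φ (Fin 3),
      IsB0Aut Φ τ → IsB0Aut Φ τ' → τ ≠ τ' →
        ¬ (IsLinearAut Φ (τ⁻¹ * τ') ∧ IsTriangularAut Φ (τ⁻¹ * τ'))) := by
  constructor
  · rintro μ ⟨α, β₂, β₃, γ₂, γ₃, h, ⟨u, rfl⟩, hdet, hh, h0, h1, h2⟩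
    obtain ⟨s, t, hd⟩ := exists_sub_mem_derivedSeries_one hh
    have hl : s • xg Φ 1 + t • xg Φ 2 ∈
        LieSubalgebra.lieSpan Φ (FreeLieAlgebra Φ (Fin 3)) {xg Φ 1, xg Φ 2} :=
      add_mem
        (LieSubalgebra.smul_mem _ s (LieSubalgebra.subset_lieSpan (Set.mem_insert _ _)))
        (LieSubalgebra.smul_mem _ t
          (LieSubalgebra.subset_lieSpan (Set.mem_insert_of_mem _ rfl)))
    set k : FreeLieAlgebra Φ (Fin 3) :=
      (↑u⁻¹ : Φ) • (h - (s • xg Φ 1 + t • xg Φ 2)) with hk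
    have hkL : k ∈ LieSubalgebra.lieSpan Φ (FreeLieAlgebra Φ (Fin 3)) {xg Φ 1, xg Φ 2} :=
      LieSubalgebra.smul_mem _ _ (sub_mem hh hl)
    have hkD : k ∈ LieAlgebra.derivedSeries Φ (FreeLieAlgebra Φ (Fin 3)) 1 :=
      (LieAlgebra.derivedSeries Φ _ 1).smul_mem _ hd
    have huk : (u : Φ) • k = h - (s • xg Φ 1 + t • xg Φ 2) := by
      rw [hk, smul_smul, Units.mul_inv, one_smul]
    have g0 : ((elementaryAut k hkL)⁻¹ * μ) (xg Φ 0) =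
        (u : Φ) • xg Φ 0 + (s • xg Φ 1 + t • xg Φ 2) := by
      rw [lieAut_mul_apply, elementaryAut_inv_apply, h0, map_add, map_smul, elementaryHom_zero,
        (elementaryHom Φ (-k)).apply_eq_self_of_mem_lieSpan_pair (elementaryHom_one _)
          (elementaryHom_two _) hh, smul_add, smul_neg, huk]
      abel
    have g1 : ((elementaryAut k hkL)⁻¹ * μ) (xg Φ 1) = β₂ • xg Φ 1 + β₃ • xg Φ 2 := by
      rw [lieAut_mul_apply, elementaryAut_inv_apply, h1, map_add, map_smul, map_smul,
        elementaryHom_one, elementaryHom_two]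
    have g2 : ((elementaryAut k hkL)⁻¹ * μ) (xg Φ 2) = γ₂ • xg Φ 1 + γ₃ • xg Φ 2 := by
      rw [lieAut_mul_apply, elementaryAut_inv_apply, h2, map_add, map_smul, map_smul,
        elementaryHom_one, elementaryHom_two]
    have hspan : ∀ a b : Φ,
        a • xg Φ 1 + b • xg Φ 2 ∈ Submodule.span Φ (Set.range (xg Φ)) := fun a b =>
      add_mem (Submodule.smul_mem _ a (xg_mem_span 1)) (Submodule.smul_mem _ b (xg_mem_span 2))
    refine ⟨elementaryAut k hkL, (elementaryAut k hkL)⁻¹ * μ,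
      ⟨k, hkL, hkD, elementaryHom_zero k, elementaryHom_one k, elementaryHom_two k⟩,
      ⟨fun i => ?_, u, β₂, β₃, γ₂, γ₃, _, u.isUnit, hdet, hl, g0, g1, g2⟩,
      (mul_inv_cancel_left _ _).symm⟩
    match i with
    | 0 =>
      rw [g0]
      exact add_mem (Submodule.smul_mem _ _ (xg_mem_span 0)) (hspan s t)
    | 1 => exact g1 ▸ hspan β₂ β₃
    | 2 => exact g2 ▸ hspan γ₂ γ₃
  · rintro τ τ' ⟨h, hL, hD, h0, h1, h2⟩ ⟨h', hL', hD', h0', h1', h2'⟩ hne ⟨hlin, -⟩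
    have hfix : ∀ {x}, x ∈ LieSubalgebra.lieSpan Φ (FreeLieAlgebra Φ (Fin 3))
        {xg Φ 1, xg Φ 2} → τ x = x := fun hx =>
      τ.toLieHom.apply_eq_self_of_mem_lieSpan_pair h1 h2 hx
    have hτ : τ (xg Φ 0 + (h' - h)) = τ' (xg Φ 0) := by
      rw [map_add, hfix (sub_mem hL' hL), h0, h0']
      abel
    have hval : (τ⁻¹ * τ') (xg Φ 0) = xg Φ 0 + (h' - h) := by
      apply τ.injective
      change (τ * (τ⁻¹ * τ')) (xg Φ 0) = τ (xg Φ 0 + (h' - h))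
      rw [mul_inv_cancel_left, hτ]
    have hspan : h' - h ∈ Submodule.span Φ (Set.range (xg Φ)) := by
      have h3 := sub_mem (hlin 0) (xg_mem_span 0)
      rwa [hval, add_sub_cancel_left] at h3
    have heq : h' - h = 0 :=
      FreeLieAlgebra.eq_zero_of_mem_span_of_mem_derivedSeries_one hspan (sub_mem hD' hD)
    refine hne (lieAut_ext fun i => ?_)
    match i with
    | 0 => rw [← hτ, heq, add_zero]
    | 1 => rw [h1, h1']
    | 2 => rw [h2, h2']
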